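/- arXiv:2201.04699 — 4 statements merged into one kernel-verified Lean document; each statement's English description precedes it below -/
import Mathlib

section
/- Let Y be a finite nonempty type, d a natural number, and π : ℝ^d → Y → ℝ a parameterized policy, i.e. for every parameter vector w and every y ∈ Y, π(w, y) > 0 and ∑_{y ∈ Y} π(w, y) = 1. Fix w₀ ∈ ℝ^d, assume each map w ↦ π(w, y) is differentiable at w₀, let r : Y → ℝ be a reward function, and define J(w) = ∑_{y ∈ Y} π(w, y) · r(y). For each coordinate i, let η_i > 0 be a learning rate and b_i ∈ ℝ a baseline, and define the expected REINFORCE update Δ̄ ∈ ℝ^d componentwise by Δ̄_i = η_i · ∑_{y ∈ Y} π(w₀, y) · (r(y) − b_i) · ∂_i (log π(·, y))(w₀). Then the inner product ⟨Δ̄, ∇J(w₀)⟩ is non-negative, and it equals zero if and only if ∇J(w₀) = 0. -/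
/-- The score function has expected value zero at every point of differentiability, so
subtracting a baseline from the reward does not change the expected score-weighted reward, which is
the derivative of the expected reward. -/
theorem sum_mul_sub_mul_fderiv_log_eq_fderiv_sum {E Y : Type*} [NormedAddCommGroup E]
    [NormedSpace ℝ E] [Fintype Y] {π : E → Y → ℝ} {w₀ : E} (hpos : ∀ y, 0 < π w₀ y)
    (hsum : ∀ w, ∑ y : Y, π w y = 1)
    (hdiff : ∀ y, DifferentiableAt ℝ (fun w => π w y) w₀) (r : Y → ℝ) (b : ℝ) (v : E) :
    ∑ y : Y, π w₀ y * (r y - b) * fderiv ℝ (fun w => Real.log (π w y)) w₀ v =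
      fderiv ℝ (fun w => ∑ y : Y, π w y * r y) w₀ v := by
  have hzero : ∑ y : Y, fderiv ℝ (fun w => π w y) w₀ v = 0 := by
    have h : fderiv ℝ (fun w => ∑ y : Y, π w y) w₀ = 0 := by simp [hsum]
    rw [fderiv_fun_sum fun y _ => hdiff y] at h
    simpa using congrArg (fun L => L v) h
  have hterm (y : Y) : π w₀ y * (r y - b) * fderiv ℝ (fun w => Real.log (π w y)) w₀ v =
      r y * fderiv ℝ (fun w => π w y) w₀ v - b * fderiv ℝ (fun w => π w y) w₀ v := by
    rw [fderiv.log (hdiff y) (hpos y).ne']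
    have := (hpos y).ne'
    simp only [smul_apply, smul_eq_mul]
    field_simp
  have hJ : fderiv ℝ (fun w => ∑ y : Y, π w y * r y) w₀ v =
      ∑ y : Y, r y * fderiv ℝ (fun w => π w y) w₀ v := by
    rw [fderiv_fun_sum fun y _ => (hdiff y).mul_const (r y)]
    simp [fderiv_mul_const, hdiff]
  simp_rw [hterm, hJ, Finset.sum_sub_distrib, ← Finset.mul_sum, hzero, mul_zero, sub_zero]

/-- Williams's theorem for REINFORCE (first part): the inner product of the
expected REINFORCE update `Δ̄` (with per-coordinate learning rates `η i > 0` and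
baselines `b i`) with the gradient `∇J(w₀)` of the expected reward is
non-negative, and it is zero if and only if `∇J(w₀) = 0`. -/
theorem reinforce_inner_product_nonneg {Y : Type*} [Fintype Y] [Nonempty Y] {d : ℕ}
    (π : (Fin d → ℝ) → Y → ℝ)
    (hpos : ∀ w y, 0 < π w y)
    (hsum : ∀ w, ∑ y : Y, π w y = 1)
    (w₀ : Fin d → ℝ)
    (hdiff : ∀ y, DifferentiableAt ℝ (fun w => π w y) w₀)
    (r : Y → ℝ)
    (η : Fin d → ℝ) (hη : ∀ i, 0 < η i)
    (b : Fin d → ℝ)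
    (Δ : Fin d → ℝ)
    (hΔ : ∀ i, Δ i = η i * ∑ y : Y, π w₀ y * (r y - b i) *
        (fderiv ℝ (fun w => Real.log (π w y)) w₀ (Pi.single i 1)))
    (gradJ : Fin d → ℝ)
    (hgradJ : ∀ i, gradJ i =
        fderiv ℝ (fun w => ∑ y : Y, π w y * r y) w₀ (Pi.single i 1)) :
    0 ≤ ∑ i : Fin d, Δ i * gradJ i ∧
      ((∑ i : Fin d, Δ i * gradJ i) = 0 ↔ gradJ = 0) := by
  have hscale (i : Fin d) : Δ i * gradJ i = η i * gradJ i ^ 2 := by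
    rw [hΔ, sum_mul_sub_mul_fderiv_log_eq_fderiv_sum (hpos w₀) hsum hdiff, ← hgradJ]
    ring
  have hnonneg (i : Fin d) : 0 ≤ η i * gradJ i ^ 2 := mul_nonneg (hη i).le (sq_nonneg _)
  simp_rw [hscale]
  refine ⟨Finset.sum_nonneg fun i _ => hnonneg i, ?_⟩
  rw [Finset.sum_eq_zero_iff_of_nonneg fun i _ => hnonneg i]
  simp [funext_iff, fun i => (hη i).ne']
end

section
/- Let Y be a finite nonempty type, d a natural number, and π : ℝ^d → Y → ℝ a parameterized policy, i.e. for every parameter vector w and every y ∈ Y, π(w, y) > 0 and ∑_{y ∈ Y} π(w, y) = 1. Fix w₀ ∈ ℝ^d, assume each map w ↦ π(w, y) is differentiable at w₀, let r : Y → ℝ be a reward function, and define J(w) = ∑_{y ∈ Y} π(w, y) · r(y). Suppose the learning rate is a single constant η > 0 independent of the coordinate, and b_i ∈ ℝ are arbitrary baselines. Define Δ̄ ∈ ℝ^d componentwise by Δ̄_i = η · ∑_{y ∈ Y} π(w₀, y) · (r(y) − b_i) · ∂_i (log π(·, y))(w₀). Then Δ̄ = η · ∇J(w₀); that is, the average REINFORCE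 update vector equals the learning rate times the gradient of the expected reward. -/
/-- The score-function (log-derivative) identity: the expectation under the policy `π w₀` of
`f` times the score is the derivative of the expectation of `f`. -/
theorem sum_mul_fderiv_log_eq_fderiv_sum {E Y : Type*} [NormedAddCommGroup E] [NormedSpace ℝ E]
    [Fintype Y] {π : E → Y → ℝ} {w₀ : E} (hne : ∀ y, π w₀ y ≠ 0)
    (hdiff : ∀ y, DifferentiableAt ℝ (fun w => π w y) w₀) (f : Y → ℝ) (v : E) :
    ∑ y, π w₀ y * f y * fderiv ℝ (fun w => Real.log (π w y)) w₀ v =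
      fderiv ℝ (fun w => ∑ y, π w y * f y) w₀ v := by
  rw [fderiv_fun_sum fun y _ => (hdiff y).mul_const (f y), sum_apply]
  refine Finset.sum_congr rfl fun y _ => ?_
  rw [fderiv.log (hdiff y) (hne y), fderiv_mul_const (hdiff y)]
  simp only [smul_apply, smul_eq_mul]
  field [hne y]

/-- Williams's theorem for REINFORCE (second part): if the learning rate `η > 0`
is a single constant independent of the coordinate, then the expected REINFORCE
update vector equals `η` times the gradient of the expected reward:
`Δ̄ = η • ∇J(w₀)`. -/
theorem reinforce_expected_update_eq_grad {Y : Type*} [Fintype Y] [Nonempty Y] {d : ℕ}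
    (π : (Fin d → ℝ) → Y → ℝ)
    (hpos : ∀ w y, 0 < π w y)
    (hsum : ∀ w, ∑ y : Y, π w y = 1)
    (w₀ : Fin d → ℝ)
    (hdiff : ∀ y, DifferentiableAt ℝ (fun w => π w y) w₀)
    (r : Y → ℝ)
    (η : ℝ) (hη : 0 < η)
    (b : Fin d → ℝ)
    (Δ : Fin d → ℝ)
    (hΔ : ∀ i, Δ i = η * ∑ y : Y, π w₀ y * (r y - b i) *
        (fderiv ℝ (fun w => Real.log (π w y)) w₀ (Pi.single i 1))) :
    Δ = fun i => η * fderiv ℝ (fun w => ∑ y : Y, π w y * r y) w₀ (Pi.single i 1) := by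
  funext i
  rw [hΔ, sum_mul_fderiv_log_eq_fderiv_sum (fun y => (hpos w₀ y).ne') hdiff]
  have hJ : (fun w => ∑ y, π w y * (r y - b i)) = fun w => (∑ y, π w y * r y) - b i := by
    funext w
    simp only [mul_sub, Finset.sum_sub_distrib, ← Finset.sum_mul, hsum, one_mul]
  rw [hJ, fderiv_sub_const]
end

section
/- Let n be a positive natural number, W : ℝ^n → ℝ^n a continuous linear map with operator norm ‖W‖ < 1, and v : ℕ → ℝ^n an arbitrary sequence of driving inputs. Define state sequences by x_{t+1} = tanh.(v_t + W x_t) and x̃_{t+1} = tanh.(v_t + W x̃_t), where tanh is applied componentwise, started from arbitrary initial states x₀, x̃₀ ∈ ℝ^n. Then the echo state property holds: ‖x_T − x̃_T‖ → 0 as T → ∞; i.e. the state sequences resulting from any two initial states, driven by the same input sequence, converge to each other. -/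
/-- The hyperbolic tangent is `1`-Lipschitz on the real line. -/
theorem Real.lipschitzWith_one_tanh : LipschitzWith 1 Real.tanh := by
  have hderiv (y : ℝ) : HasDerivAt Real.tanh (1 / Real.cosh y ^ 2) y := by
    have h := (Real.hasDerivAt_sinh y).div (Real.hasDerivAt_cosh y) (Real.cosh_pos y).ne'
    have heq : Real.tanh = Real.sinh / Real.cosh := funext Real.tanh_eq_sinh_div_cosh
    rwa [← sq, ← sq, Real.cosh_sq_sub_sinh_sq, ← heq] at h
  refine lipschitzWith_of_nnnorm_deriv_le (fun y => (hderiv y).differentiableAt) fun y => ?_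
  rw [(hderiv y).deriv, ← NNReal.coe_le_coe, coe_nnnorm, Real.norm_of_nonneg (by positivity)]
  exact div_le_one_of_le₀ (one_le_pow₀ (Real.one_le_cosh y)) (by positivity)

/-- A vector whose coordinates are the differences of the values of `tanh` at the coordinates of
`a` and `b` is no longer than `a - b` in the Euclidean norm. -/
theorem EuclideanSpace.norm_sub_le_of_eq_tanh {ι : Type*} [Fintype ι]
    {a b y z : EuclideanSpace ℝ ι} (hy : ∀ i, y i = Real.tanh (a i))
    (hz : ∀ i, z i = Real.tanh (b i)) : ‖y - z‖ ≤ ‖a - b‖ := by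
  rw [EuclideanSpace.norm_eq, EuclideanSpace.norm_eq]
  gcongr with i
  simpa [hy, hz, Real.dist_eq] using Real.lipschitzWith_one_tanh.dist_le_mul (a i) (b i)

/-- The echo state property: for the reservoir update
`x_{t+1} = tanh.(v_t + W x_t)` (componentwise `tanh`) with `‖W‖ < 1`, the state
sequences resulting from any two initial states, driven by the same input
sequence, converge to each other: `‖x_T − x̃_T‖ → 0` as `T → ∞`. -/
theorem echo_state_property {n : ℕ} (hn : 0 < n)
    (W : EuclideanSpace ℝ (Fin n) →L[ℝ] EuclideanSpace ℝ (Fin n))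
    (hW : ‖W‖ < 1)
    (v : ℕ → EuclideanSpace ℝ (Fin n))
    (x x' : ℕ → EuclideanSpace ℝ (Fin n))
    (hx : ∀ t, x (t + 1) = fun i => Real.tanh (v t i + W (x t) i))
    (hx' : ∀ t, x' (t + 1) = fun i => Real.tanh (v t i + W (x' t) i)) :
    Filter.Tendsto (fun T : ℕ => ‖x T - x' T‖) Filter.atTop (nhds 0) := by
  have hstep (t : ℕ) : ‖x (t + 1) - x' (t + 1)‖ ≤ ‖W‖ * ‖x t - x' t‖ := by
    have h : ‖x (t + 1) - x' (t + 1)‖ ≤ ‖(v t + W (x t)) - (v t + W (x' t))‖ :=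
      EuclideanSpace.norm_sub_le_of_eq_tanh (fun i => congrFun (hx t) i)
        fun i => congrFun (hx' t) i
    rw [add_sub_add_left_eq_sub, ← map_sub] at h
    exact h.trans (W.le_opNorm _)
  have hbound (T : ℕ) : ‖x T - x' T‖ ≤ ‖W‖ ^ T * ‖x 0 - x' 0‖ := by
    induction T with
    | zero => simp
    | succ T ih =>
      calc ‖x (T + 1) - x' (T + 1)‖ ≤ ‖W‖ * ‖x T - x' T‖ := hstep T
        _ ≤ ‖W‖ * (‖W‖ ^ T * ‖x 0 - x' 0‖) := by gcongr
        _ = ‖W‖ ^ (T + 1) * ‖x 0 - x' 0‖ := by ring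
  refine squeeze_zero (fun T => norm_nonneg _) hbound ?_
  simpa using (tendsto_pow_atTop_nhds_zero_of_lt_one (norm_nonneg W) hW).mul_const ‖x 0 - x' 0‖
end

section
/- Let d be a positive natural number, P a d×d real symmetric positive definite matrix, g ∈ ℝ^d, and τ a real number with 0 < τ ≤ 1. Then q = 1 + gᵀ P g / τ > 0, and with k = P g / (q τ), the updated matrix P' = τ · (P/τ − q·(k kᵀ)) produced by one step of the extended Kalman filter is again symmetric positive definite. -/
open Matrix

/-- The Cauchy–Schwarz inequality for the quadratic form of a positive semidefinite real matrix. -/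
lemma Matrix.PosSemidef.sq_dotProduct_mulVec_le {n : Type*} [Fintype n] {A : Matrix n n ℝ}
    (hA : A.PosSemidef) (x y : n → ℝ) :
    (x ⬝ᵥ A *ᵥ y) ^ 2 ≤ (x ⬝ᵥ A *ᵥ x) * (y ⬝ᵥ A *ᵥ y) := by
  have h_symm : y ⬝ᵥ A *ᵥ x = x ⬝ᵥ A *ᵥ y := by
    have hAt : Aᵀ = A := by simpa using hA.isHermitian.eq
    rw [dotProduct_comm, dotProduct_mulVec, ← mulVec_transpose, hAt]
  have h_quad (t : ℝ) :
      0 ≤ (x ⬝ᵥ A *ᵥ x) * (t * t) + 2 * (x ⬝ᵥ A *ᵥ y) * t + y ⬝ᵥ A *ᵥ y := by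
    have h := hA.dotProduct_mulVec_nonneg (t • x + y)
    simp only [star_trivial, mulVec_add, mulVec_smul, add_dotProduct, dotProduct_add,
      smul_dotProduct, dotProduct_smul, smul_eq_mul, h_symm] at h
    linarith
  have h_discrim := discrim_le_zero h_quad
  rw [discrim] at h_discrim
  linarith

/-- Subtracting `s⁻¹ (A g) (A g)ᵀ` from a positive definite real matrix `A` leaves it positive
definite as soon as `gᵀ A g < s`. -/
lemma Matrix.PosDef.sub_inv_smul_vecMulVec {n : Type*} [Fintype n] {A : Matrix n n ℝ}
    (hA : A.PosDef) {g : n → ℝ} {s : ℝ} (hs : g ⬝ᵥ A *ᵥ g < s) :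
    (A - s⁻¹ • vecMulVec (A *ᵥ g) (A *ᵥ g)).PosDef := by
  have hg : 0 ≤ g ⬝ᵥ A *ᵥ g := by simpa using hA.posSemidef.dotProduct_mulVec_nonneg g
  have hs_pos : 0 < s := hg.trans_lt hs
  have h_rank_one : (vecMulVec (A *ᵥ g) (A *ᵥ g)).PosSemidef := by
    simpa using posSemidef_vecMulVec_self_star (A *ᵥ g)
  refine .of_dotProduct_mulVec_pos
    (hA.isHermitian.sub (h_rank_one.smul (inv_nonneg.2 hs_pos.le)).isHermitian) fun x hx => ?_
  have hx_pos : 0 < x ⬝ᵥ A *ᵥ x := by simpa using hA.dotProduct_mulVec_pos hx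
  have h_form : star x ⬝ᵥ (A - s⁻¹ • vecMulVec (A *ᵥ g) (A *ᵥ g)) *ᵥ x =
      x ⬝ᵥ A *ᵥ x - (x ⬝ᵥ A *ᵥ g) ^ 2 / s := by
    simp only [star_trivial, sub_mulVec, smul_mulVec, vecMulVec_mulVec, dotProduct_sub,
      dotProduct_smul, op_smul_eq_smul, smul_eq_mul, dotProduct_comm (A *ᵥ g) x]
    ring
  rw [h_form, sub_pos, div_lt_iff₀ hs_pos]
  exact (hA.posSemidef.sq_dotProduct_mulVec_le x g).trans_lt (by gcongr)

/-- One step of the extended Kalman filter preserves symmetric positive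
definiteness: if `P` is symmetric positive definite and `0 < τ ≤ 1`, then
`q = 1 + gᵀ P g / τ > 0`, and with gain `k = P g / (q τ)`, the updated,
variance-stabilised precision matrix `P' = τ (P/τ − q k kᵀ)` is again symmetric
positive definite. -/
theorem ekf_preserves_posdef {d : ℕ} (hd : 0 < d)
    (P : Matrix (Fin d) (Fin d) ℝ) (hP : P.PosDef)
    (g : Fin d → ℝ) (τ : ℝ) (hτ : 0 < τ) (hτ1 : τ ≤ 1)
    (q : ℝ) (hq : q = 1 + g ⬝ᵥ P.mulVec g / τ)
    (k : Fin d → ℝ) (hk : k = (q * τ)⁻¹ • P.mulVec g) :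
    0 < q ∧ (τ • (τ⁻¹ • P - q • vecMulVec k k)).PosDef := by
  have hg : 0 ≤ g ⬝ᵥ P *ᵥ g := by simpa using hP.posSemidef.dotProduct_mulVec_nonneg g
  have hq_pos : 0 < q := by rw [hq]; positivity
  have hqτ : q * τ = τ + g ⬝ᵥ P *ᵥ g := by rw [hq]; field_simp
  have h_update : τ • (τ⁻¹ • P - q • vecMulVec k k) =
      P - (q * τ)⁻¹ • vecMulVec (P *ᵥ g) (P *ᵥ g) := by
    ext i j
    simp only [hk, Matrix.smul_apply, Matrix.sub_apply, vecMulVec_apply, Pi.smul_apply, smul_eq_mul]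
    field_simp
  rw [h_update]
  exact ⟨hq_pos, hP.sub_inv_smul_vecMulVec (by linarith)⟩
end
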